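/- Let A_n be the free associative unital ℂ-algebra on generators x_1,…,x_n, and write y_{ij} = [x_i,x_j] and z_{ijk} = [[x_i,x_j],x_k]. The ideal M_4(A_n) equals the two-sided ideal of A_n generated by: the elements [x_i, z_{jlm}] for all indices i,j,l,m; the elements y_{ij}·z_{klm} for all indices i,j,k,l,m; and the elements y_{ij}y_{kl}y_{mp} + y_{ik}y_{jl}y_{mp} for all indices i,j,k,l,m,p. -/

import Mathlib

noncomputable section

/-- `lcs k A n` is the `(n+1)`-st term `L_{n+1}(A)` of the lower central series of `A`
regarded as a Lie algebra under the commutator `[a,b] = a*b - b*a`: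
`lcs k A 0 = L_1(A) = A` and `L_{n+2}(A) = span [A, L_{n+1}(A)]`. -/
def lcs (k A : Type*) [Field k] [Ring A] [Algebra k A] : ℕ → Submodule k A
  | 0 => ⊤
  | n + 1 => Submodule.span k {x | ∃ a : A, ∃ b ∈ lcs k A n, x = a * b - b * a}

/-- `Lser k A i = L_i(A)` for `i ≥ 1`. -/
def Lser (k A : Type*) [Field k] [Ring A] [Algebra k A] (i : ℕ) : Submodule k A :=
  lcs k A (i - 1)

/-- The two-sided ideal of `A` generated by a set `S`, as a `k`-submodule. -/
def idealGen (k : Type*) {A : Type*} [Field k] [Ring A] [Algebra k A] (S : Set A) :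
    Submodule k A :=
  Submodule.span k {x | ∃ a b : A, ∃ s ∈ S, x = a * s * b}

/-- `Mser k A i = M_i(A)`, the two-sided ideal of `A` generated by `L_i(A)`. -/
def Mser (k A : Type*) [Field k] [Ring A] [Algebra k A] (i : ℕ) : Submodule k A :=
  idealGen k (Lser k A i : Set A)

/-- The commutator `[a, b] = a*b - b*a`. -/
def ringComm {A : Type*} [Ring A] (a b : A) : A := a * b - b * a

/-- `y i j = [x_i, x_j]` in the free algebra. -/
def yGen {n : ℕ} (i j : Fin n) : FreeAlgebra ℂ (Fin n) :=
  ringComm (FreeAlgebra.ι ℂ i) (FreeAlgebra.ι ℂ j)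

/-- `z i j k = [[x_i, x_j], x_k]` in the free algebra. -/
def zGen {n : ℕ} (i j k : Fin n) : FreeAlgebra ℂ (Fin n) :=
  ringComm (yGen i j) (FreeAlgebra.ι ℂ k)
section Commutators

variable {R : Type*} [Ring R]

theorem ringComm_swap (a b : R) : ringComm a b = -ringComm b a := by
  simp [ringComm]

theorem ringComm_mul (a b c : R) :
    ringComm a (b * c) = ringComm a b * c + b * ringComm a c := by
  simp only [ringComm]; noncomm_ring

theorem ringComm_mul_left (a b c : R) :
    ringComm (a * b) c = a * ringComm b c + ringComm a c * b := by
  simp only [ringComm]; noncomm_ring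

theorem ringComm_add (a b c : R) : ringComm a (b + c) = ringComm a b + ringComm a c := by
  simp only [ringComm]; noncomm_ring

theorem ringComm_eq_zero_iff {a b : R} : ringComm a b = 0 ↔ a * b = b * a := sub_eq_zero

theorem ringComm_of_mem_center {c : R} (hc : c ∈ Subring.center R) (a : R) :
    ringComm a c = 0 :=
  ringComm_eq_zero_iff.2 (Subring.mem_center_iff.1 hc a)

theorem mem_center_iff_ringComm {c : R} :
    c ∈ Subring.center R ↔ ∀ a, ringComm c a = 0 := by
  simp only [Subring.mem_center_iff, ringComm_eq_zero_iff, eq_comm]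

theorem map_ringComm {S : Type*} [Ring S] (f : R →+* S) (a b : R) :
    f (ringComm a b) = ringComm (f a) (f b) := by
  simp [ringComm]

end Commutators

section Generators

variable {R X : Type*} [Ring R] {x : X → R}

/-- An induction principle for a ring generated by a family and its center, building elements
by multiplication on the right by generators. -/
theorem induction_mul_generator
    (hgen : Subring.closure (Set.range x ∪ Subring.center R) = ⊤) {P : R → Prop}
    (one : P 1) (add : ∀ d e, P d → P e → P (d + e))
    (smul : ∀ c ∈ Subring.center R, ∀ d, P d → P (c * d))
    (mul : ∀ d m, P d → P (d * x m)) (d : R) : P d := by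
  suffices h : ∀ e, P e → P (e * d) by simpa using h 1 one
  have hd : d ∈ Subring.closure (Set.range x ∪ Subring.center R) := hgen ▸ Subring.mem_top d
  induction hd using Subring.closure_induction with
  | mem u hu =>
    intro e he
    rcases hu with ⟨m, rfl⟩ | hu
    · exact mul e m he
    · rw [Subring.mem_center_iff.1 hu e]
      exact smul u hu e he
  | zero => intro e he; simpa using smul 0 (zero_mem _) e he
  | one => intro e he; simpa using he
  | add u v _ _ hu hv =>
    intro e he
    rw [mul_add]
    exact add _ _ (hu e he) (hv e he)
  | neg u _ hu =>
    intro e he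
    simpa using smul (-1) (neg_mem (one_mem _)) _ (hu e he)
  | mul u v _ _ hu hv =>
    intro e he
    rw [← mul_assoc]
    exact hv _ (hu e he)

theorem mem_center_of_commute_generators
    (hgen : Subring.closure (Set.range x ∪ Subring.center R) = ⊤) {u : R}
    (hu : ∀ k, ringComm u (x k) = 0) : u ∈ Subring.center R := by
  rw [mem_center_iff_ringComm]
  intro a
  induction a using induction_mul_generator hgen with
  | one => simp [ringComm]
  | add d e hd he => rw [ringComm_add, hd, he, add_zero]
  | smul c hc d hd => rw [ringComm_mul, ringComm_of_mem_center hc, hd]; simp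
  | mul d m hd => rw [ringComm_mul, hd, hu]; simp

theorem mul_ringComm_eq_zero_of_generators
    (hgen : Subring.closure (Set.range x ∪ Subring.center R) = ⊤) {w : R}
    (hw : w ∈ Subring.center R) (h : ∀ i j, w * ringComm (x i) (x j) = 0) (a b : R) :
    w * ringComm a b = 0 := by
  have key : ∀ a : R, (∀ m, w * ringComm a (x m) = 0) → ∀ b, w * ringComm a b = 0 := by
    intro a ha b
    induction b using induction_mul_generator hgen with
    | one => simp [ringComm]
    | add d e hd he => rw [ringComm_add, mul_add, hd, he, add_zero]
    | smul c hc d hd =>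
      rw [ringComm_mul, ringComm_of_mem_center hc, zero_mul, zero_add, ← mul_assoc,
        ← Subring.mem_center_iff.1 hw, mul_assoc, hd, mul_zero]
    | mul d m hd =>
      rw [ringComm_mul, mul_add, ← mul_assoc, hd, ← mul_assoc,
        ← Subring.mem_center_iff.1 hw, mul_assoc, ha]
      simp
  refine key a (fun m => ?_) b
  rw [ringComm_swap, mul_neg, key (x m) (h m), neg_zero]

/-- The inductive step for `ringComm_mem_center_of_generators`, with the first entry of the
commutator fixed. -/
theorem ringComm_mem_center_aux
    (hgen : Subring.closure (Set.range x ∪ Subring.center R) = ⊤) {a : R}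
    (hy : ∀ i j, ringComm (x i) (x j) ∈ Subring.center R)
    (ha : ∀ m, ringComm a (x m) ∈ Subring.center R)
    (hq : ∀ m l k, ringComm a (x m) * ringComm (x l) (x k) +
      ringComm (x k) (x m) * ringComm (x l) a = 0) (d : R) :
    ringComm a d ∈ Subring.center R ∧
      ∀ l k, ringComm a d * ringComm (x l) (x k) + ringComm (x k) d * ringComm (x l) a = 0 := by
  induction d using induction_mul_generator hgen with
  | one => simp [ringComm]
  | add d e hd he =>
    refine ⟨by rw [ringComm_add]; exact add_mem hd.1 he.1, fun l k => ?_⟩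
    rw [ringComm_add, ringComm_add, add_mul, add_mul, add_add_add_comm, hd.2, he.2, add_zero]
  | smul c hc d hd =>
    have h : ∀ b, ringComm b (c * d) = c * ringComm b d := fun b => by
      rw [ringComm_mul, ringComm_of_mem_center hc, zero_mul, zero_add]
    refine ⟨by rw [h]; exact mul_mem hc hd.1, fun l k => ?_⟩
    rw [h, h, mul_assoc, mul_assoc, ← mul_add, hd.2, mul_zero]
  | mul d m hd =>
    have hla : ∀ l, ringComm (x l) a ∈ Subring.center R := fun l => by
      rw [ringComm_swap]; exact neg_mem (ha l)
    constructor
    · apply mem_center_of_commute_generators hgen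
      intro k
      have h1 := ringComm_eq_zero_iff.1 (mem_center_iff_ringComm.1 hd.1 (x k))
      have h2 := ringComm_eq_zero_iff.1 (mem_center_iff_ringComm.1 (ha m) (x k))
      have h3 := hd.2 m k
      have : ringComm (ringComm a (d * x m)) (x k) =
          ringComm a d * ringComm (x m) (x k) + ringComm (x k) d * ringComm (x m) a +
          (ringComm a d * x k - x k * ringComm a d) * x m +
          d * (ringComm a (x m) * x k - x k * ringComm a (x m)) := by
        simp only [ringComm]; noncomm_ring
      rw [this, h3, h1, h2]; simp
    · intro l k
      rw [ringComm_mul, ringComm_mul, add_mul, add_mul, mul_assoc, mul_assoc, mul_assoc, mul_assoc,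
        Subring.mem_center_iff.1 (hy l k) (x m), Subring.mem_center_iff.1 (hla l) (x m),
        add_add_add_comm, ← mul_assoc, ← mul_assoc, ← add_mul, ← mul_add, hd.2, hq]
      simp

/-- If the commutators of generators are central and the products of two of them are
alternating, then all commutators are central. -/
theorem ringComm_mem_center_of_generators
    (hgen : Subring.closure (Set.range x ∪ Subring.center R) = ⊤)
    (hy : ∀ i j, ringComm (x i) (x j) ∈ Subring.center R)
    (hq : ∀ i j k l, ringComm (x i) (x j) * ringComm (x k) (x l) +
      ringComm (x i) (x k) * ringComm (x j) (x l) = 0) (a b : R) :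
    ringComm a b ∈ Subring.center R := by
  let y : X → X → R := fun i j => ringComm (x i) (x j)
  have h1 : ∀ i d, _ := fun i d => ringComm_mem_center_aux hgen (a := x i) hy (hy i)
    (fun m l k => by
      have s12 : ∀ i j k l, y i j * y k l = -(y j i * y k l) := fun i j k l => by
        rw [← neg_mul]; exact congrArg (· * _) (ringComm_swap _ _)
      have s34 : ∀ i j k l, y i j * y k l = -(y i j * y l k) := fun i j k l => by
        rw [← mul_neg]; exact congrArg (_ * ·) (ringComm_swap _ _)
      have s23 : ∀ i j k l, y i j * y k l = -(y i k * y j l) := fun i j k l =>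
        eq_neg_of_add_eq_zero_left (hq i j k l)
      change y i m * y l k + y k m * y l i = 0
      rw [s12 k m, s23 m k, s34 m l, s23 m l, s12 m i]
      simp) d
  refine (ringComm_mem_center_aux hgen (a := a) hy (fun m => ?_) (fun m l k => ?_) b).1
  · rw [ringComm_swap]; exact neg_mem (h1 m a).1
  · have e1 := (h1 m a).2 l k
    have e2 := (h1 k a).2 m l
    rw [Subring.mem_center_iff.1 (h1 l a).1, ringComm_swap a, ringComm_swap (x k) (x m)]
    rw [ringComm_swap (x l) (x m)] at e1
    simp only [mul_neg, neg_mul] at e1 ⊢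
    rw [add_neg_eq_zero] at e1
    rw [← e1] at e2
    rw [← neg_add, e2, neg_zero]

/-- The central elements annihilating all commutators form a two-sided ideal. -/
def centralAnnihilator (R : Type*) [Ring R] : TwoSidedIdeal R :=
  .mk' {w | w ∈ Subring.center R ∧ ∀ a b, w * ringComm a b = 0}
    ⟨zero_mem _, by simp⟩
    (fun hu hv => ⟨add_mem hu.1 hv.1, fun a b => by rw [add_mul, hu.2, hv.2, add_zero]⟩)
    (fun hu => ⟨neg_mem hu.1, fun a b => by rw [neg_mul, hu.2, neg_zero]⟩)
    (fun {c w} hw => by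
      refine ⟨mem_center_iff_ringComm.2 fun a => ?_, fun a b => by rw [mul_assoc, hw.2, mul_zero]⟩
      rw [ringComm_mul_left, mem_center_iff_ringComm.1 hw.1, mul_zero, zero_add,
        Subring.mem_center_iff.1 hw.1, hw.2])
    (fun {w c} hw => by
      rw [← Subring.mem_center_iff.1 hw.1 c]
      refine ⟨mem_center_iff_ringComm.2 fun a => ?_, fun a b => by rw [mul_assoc, hw.2, mul_zero]⟩
      rw [ringComm_mul_left, mem_center_iff_ringComm.1 hw.1, mul_zero, zero_add,
        Subring.mem_center_iff.1 hw.1, hw.2])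

theorem mem_centralAnnihilator {w : R} : w ∈ centralAnnihilator R ↔
    w ∈ Subring.center R ∧ ∀ a b, w * ringComm a b = 0 := by
  simp [centralAnnihilator, TwoSidedIdeal.mem_mk']

theorem closure_range_comp_union_center {S : Type*} [Ring S] (f : R →+* S)
    (hf : Function.Surjective f)
    (hgen : Subring.closure (Set.range x ∪ Subring.center R) = ⊤) :
    Subring.closure (Set.range (f ∘ x) ∪ Subring.center S) = ⊤ := by
  rw [eq_top_iff, ← RingHom.range_eq_top.2 hf, RingHom.range_eq_map, ← hgen, RingHom.map_closure,
    Subring.closure_le]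
  rintro _ ⟨u, ⟨m, rfl⟩ | hu, rfl⟩
  · exact Subring.subset_closure (Or.inl ⟨m, rfl⟩)
  · refine Subring.subset_closure (Or.inr (Subring.mem_center_iff.2 fun s => ?_))
    obtain ⟨r, rfl⟩ := hf s
    rw [← map_mul, Subring.mem_center_iff.1 hu, map_mul]

theorem TwoSidedIdeal.mk'_ringCon_eq_zero_iff (I : TwoSidedIdeal R) {a : R} :
    I.ringCon.mk' a = 0 ↔ a ∈ I := by
  rw [← TwoSidedIdeal.mem_ker, TwoSidedIdeal.ker_ringCon_mk']

/-- The relations on the generators imply that the ring is Lie nilpotent of class three. -/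
theorem ringComm_ringComm_mem_center_of_generators
    (hgen : Subring.closure (Set.range x ∪ Subring.center R) = ⊤)
    (hz : ∀ i j l m, ringComm (x i) (ringComm (ringComm (x j) (x l)) (x m)) = 0)
    (hyz : ∀ i j k l m, ringComm (x i) (x j) * ringComm (ringComm (x k) (x l)) (x m) = 0)
    (hq : ∀ i j k l m p,
      ringComm (x i) (x j) * ringComm (x k) (x l) * ringComm (x m) (x p) +
      ringComm (x i) (x k) * ringComm (x j) (x l) * ringComm (x m) (x p) = 0) (a b c : R) :
    ringComm (ringComm a b) c ∈ Subring.center R := by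
  have hzc : ∀ i j k, ringComm (ringComm (x i) (x j)) (x k) ∈ Subring.center R := fun i j k =>
    mem_center_of_commute_generators hgen fun m => by rw [ringComm_swap, hz, neg_zero]
  have hzN : ∀ i j k,
      ringComm (ringComm (x i) (x j)) (x k) ∈ centralAnnihilator R := fun i j k =>
    mem_centralAnnihilator.2 ⟨hzc i j k, mul_ringComm_eq_zero_of_generators hgen (hzc i j k)
      fun l m => by rw [← Subring.mem_center_iff.1 (hzc i j k), hyz]⟩
  have hqN : ∀ i j k l, ringComm (x i) (x j) * ringComm (x k) (x l) +
      ringComm (x i) (x k) * ringComm (x j) (x l) ∈ centralAnnihilator R := by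
    intro i j k l
    have hyy : ∀ i j k l m, ringComm (ringComm (x i) (x j) * ringComm (x k) (x l)) (x m) = 0 := by
      intro i j k l m
      rw [ringComm_mul_left, hyz, (mem_centralAnnihilator.1 (hzN i j m)).2, add_zero]
    have hc : ringComm (x i) (x j) * ringComm (x k) (x l) +
        ringComm (x i) (x k) * ringComm (x j) (x l) ∈ Subring.center R :=
      add_mem (mem_center_of_commute_generators hgen (hyy i j k l))
        (mem_center_of_commute_generators hgen (hyy i k j l))
    exact mem_centralAnnihilator.2 ⟨hc, mul_ringComm_eq_zero_of_generators hgen hc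
      fun m p => by rw [add_mul, hq]⟩
  let f := (centralAnnihilator R).ringCon.mk'
  have hf : Function.Surjective f := RingCon.mk'_surjective _
  have hf0 : ∀ {a}, f a = 0 ↔ a ∈ centralAnnihilator R :=
    (centralAnnihilator R).mk'_ringCon_eq_zero_iff
  have hgen' := closure_range_comp_union_center f hf hgen
  have key := ringComm_mem_center_of_generators hgen'
    (fun i j => mem_center_of_commute_generators hgen' fun k => by
      simp only [Function.comp, ← map_ringComm]
      exact hf0.2 (hzN i j k))
    (fun i j k l => by
      simp only [Function.comp, ← map_ringComm, ← map_mul, ← map_add]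
      exact hf0.2 (hqN i j k l)) (f a) (f b)
  have := mem_center_iff_ringComm.1 key (f c)
  rw [← map_ringComm, ← map_ringComm, hf0] at this
  exact (mem_centralAnnihilator.1 this).1

end Generators

section LieNilpotent

variable {R : Type*} [Ring R]

/-- In a ring without `3`-torsion which is Lie nilpotent of class three, triple commutators
annihilate commutators. -/
theorem ringComm_ringComm_mul_ringComm_eq_zero (h3 : ∀ t : R, t + t + t = 0 → t = 0)
    (h : ∀ a b c : R, ringComm (ringComm a b) c ∈ Subring.center R) (a b c d e : R) :
    ringComm (ringComm a b) c * ringComm d e = 0 := by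
  let T : R → R → R → R → R → R := fun a b c d e => ringComm (ringComm a b) c * ringComm d e
  have hcomm : ∀ a b c d e : R, ringComm d e * ringComm (ringComm a b) c = T a b c d e :=
    fun a b c d e => Subring.mem_center_iff.1 (h a b c) _
  have h0 : ∀ a b c d : R, ringComm (ringComm (ringComm a b) c) d = 0 :=
    fun a b c d => mem_center_iff_ringComm.1 (h a b c) d
  have swap12 : ∀ a b c d e, T b a c d e = -T a b c d e := by
    intros; simp only [T, ringComm]; noncomm_ring
  have swap45 : ∀ a b c d e, T a b c e d = -T a b c d e := by
    intros; simp only [T, ringComm]; noncomm_ring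
  have jacobi : ∀ a b c d e, T a b c d e + T b c a d e + T c a b d e = 0 := by
    intros; simp only [T, ringComm]; noncomm_ring
  have cyc : ∀ a b c d e, T a b d e c = T a b c d e := by
    intro a b c d e
    have h1 : ringComm (ringComm (ringComm a b) (c * d)) e =
        ringComm (ringComm (ringComm a b) c) e * d + c * ringComm (ringComm (ringComm a b) d) e +
        (T a b c d e - ringComm e c * ringComm (ringComm a b) d) := by
      simp only [T, ringComm]; noncomm_ring
    rw [h0, h0, h0, hcomm] at h1
    simp only [zero_mul, mul_zero, zero_add] at h1
    exact (sub_eq_zero.1 h1.symm).symm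
  have swap14 : ∀ a b c d e, T d b c a e = -T a b c d e := by
    intro a d e b c
    have h1 : ringComm (ringComm (ringComm (a * b) c) d) e =
        ringComm (ringComm (ringComm a c) d) e * b + a * ringComm (ringComm (ringComm b c) d) e +
        (ringComm a e * ringComm (ringComm b c) d + T a c d b e +
         ringComm a d * ringComm (ringComm b c) e + T a d e b c +
         ringComm a c * ringComm (ringComm b d) e + T a c e b d) := by
      simp only [T, ringComm]; noncomm_ring
    rw [h0, h0, h0, hcomm, hcomm, hcomm] at h1
    simp only [zero_mul, mul_zero, zero_add] at h1
    have e1 : T a c e b d = -T a c d b e := by rw [cyc, swap45, cyc]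
    have e2 : T b c e a d = -T b c d a e := by rw [cyc, swap45, cyc]
    rw [e1, e2] at h1
    grind
  have swap34 : ∀ a b c d e, T a b d c e = -T a b c d e := by
    intro a b c d e
    rw [← cyc, swap45, cyc, cyc]
  have swap13 : ∀ a b c d e, T c b a d e = -T a b c d e := by
    intro a b c d e
    rw [swap34, swap14, swap34, neg_neg]
  have rot : ∀ a b c d e, T b c a d e = T a b c d e := by
    intro a b c d e
    rw [swap12, swap13, neg_neg]
  apply h3
  simpa only [rot] using jacobi a b c d e

theorem ringComm_mul_ringComm_add_mul_ringComm_eq_zero (h3 : ∀ t : R, t + t + t = 0 → t = 0)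
    (h : ∀ a b c : R, ringComm (ringComm a b) c ∈ Subring.center R) (a b c d e f : R) :
    ringComm a b * ringComm c d * ringComm e f +
      ringComm a c * ringComm b d * ringComm e f = 0 := by
  have h0 := ringComm_ringComm_mul_ringComm_eq_zero h3 h
  have h1 : ringComm a b * ringComm c d * ringComm e f +
      ringComm a c * ringComm b d * ringComm e f =
      a * (ringComm (ringComm d c) b * ringComm e f) +
      d * (ringComm (ringComm a c) b * ringComm e f) +
      ringComm (ringComm (ringComm a c) b) d * ringComm e f -
      ringComm (ringComm (a * d) c) b * ringComm e f := by
    simp only [ringComm]; noncomm_ring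
  simp [h1, h0]

end LieNilpotent

section IdealGen

variable {k A : Type*} [Field k] [Ring A] [Algebra k A]

theorem subset_idealGen (S : Set A) : S ⊆ idealGen k S := fun s hs =>
  Submodule.subset_span ⟨1, 1, s, hs, by simp⟩

theorem mul_mem_idealGen_left {S : Set A} (c : A) {u : A} (hu : u ∈ idealGen k S) :
    c * u ∈ idealGen k S := by
  induction hu using Submodule.span_induction with
  | mem u hu =>
    obtain ⟨a, b, s, hs, rfl⟩ := hu
    exact Submodule.subset_span ⟨c * a, b, s, hs, by simp only [mul_assoc]⟩
  | zero => simp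
  | add u v _ _ hu hv => rw [mul_add]; exact add_mem hu hv
  | smul r u _ hu => rw [mul_smul_comm]; exact Submodule.smul_mem _ r hu

theorem mul_mem_idealGen_right {S : Set A} (c : A) {u : A} (hu : u ∈ idealGen k S) :
    u * c ∈ idealGen k S := by
  induction hu using Submodule.span_induction with
  | mem u hu =>
    obtain ⟨a, b, s, hs, rfl⟩ := hu
    exact Submodule.subset_span ⟨a, b * c, s, hs, by simp only [mul_assoc]⟩
  | zero => simp
  | add u v _ _ hu hv => rw [add_mul]; exact add_mem hu hv
  | smul r u _ hu => rw [smul_mul_assoc]; exact Submodule.smul_mem _ r hu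

theorem idealGen_le_idealGen {S T : Set A} (h : S ⊆ idealGen k T) :
    idealGen k S ≤ idealGen k T := by
  refine Submodule.span_le.2 ?_
  rintro _ ⟨a, b, s, hs, rfl⟩
  exact mul_mem_idealGen_right b (mul_mem_idealGen_left a (h hs))

variable (k) in
/-- `idealGen` bundled as a `TwoSidedIdeal`. -/
def twoSidedIdealGen (S : Set A) : TwoSidedIdeal A :=
  .mk' (idealGen k S) (zero_mem _) add_mem neg_mem
    (mul_mem_idealGen_left _) (mul_mem_idealGen_right _)

variable (k) in
/-- The quotient map by the two-sided ideal generated by a set. -/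
def idealGenQuotientMap (S : Set A) : A →+* (twoSidedIdealGen k S).ringCon.Quotient :=
  (twoSidedIdealGen k S).ringCon.mk'

theorem idealGenQuotientMap_surjective (S : Set A) :
    Function.Surjective (idealGenQuotientMap k S) :=
  RingCon.mk'_surjective _

theorem idealGenQuotientMap_eq_zero_iff {S : Set A} {a : A} :
    idealGenQuotientMap k S a = 0 ↔ a ∈ idealGen k S := by
  refine (TwoSidedIdeal.mk'_ringCon_eq_zero_iff _).trans ?_
  simp [twoSidedIdealGen, TwoSidedIdeal.mem_mk']

end IdealGen

section LowerCentralSeries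

variable {k A B : Type*} [Field k] [Ring A] [Algebra k A] [Ring B]

theorem ringComm_mem_lcs_succ {m : ℕ} (a : A) {u : A} (hu : u ∈ lcs k A m) :
    ringComm a u ∈ lcs k A (m + 1) :=
  Submodule.subset_span ⟨a, u, hu, rfl⟩

theorem map_algebraMap_mem_center (f : A →+* B) (hf : Function.Surjective f) (r : k) :
    f (algebraMap k A r) ∈ Subring.center B := by
  refine Subring.mem_center_iff.2 fun b => ?_
  obtain ⟨a, rfl⟩ := hf b
  rw [← map_mul, ← map_mul, Algebra.commutes]

theorem map_eq_zero_of_mem_lcs_three (f : A →+* B) (hf : Function.Surjective f)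
    (h : ∀ a b c : B, ringComm (ringComm a b) c ∈ Subring.center B) {u : A}
    (hu : u ∈ lcs k A 3) : f u = 0 := by
  have hc := map_algebraMap_mem_center (k := k) f hf
  have h1 : ∀ u ∈ lcs k A 1, ∀ b, ringComm b (f u) ∈ Subring.center B := by
    intro u hu b
    induction hu using Submodule.span_induction with
    | mem u hu =>
      obtain ⟨c, d, -, rfl⟩ := hu
      rw [ringComm_swap, map_sub, map_mul, map_mul]
      exact neg_mem (h (f c) (f d) b)
    | zero => simp [ringComm]
    | add u v _ _ hu hv => rw [map_add, ringComm_add]; exact add_mem hu hv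
    | smul r u _ hu =>
      rw [Algebra.smul_def, map_mul, ringComm_mul, ringComm_of_mem_center (hc r), zero_mul,
        zero_add]
      exact mul_mem (hc r) hu
  have h2 : ∀ u ∈ lcs k A 2, f u ∈ Subring.center B := by
    intro u hu
    induction hu using Submodule.span_induction with
    | mem u hu =>
      obtain ⟨c, d, hd, rfl⟩ := hu
      rw [map_sub, map_mul, map_mul]
      exact h1 d hd (f c)
    | zero => simp
    | add u v _ _ hu hv => rw [map_add]; exact add_mem hu hv
    | smul r u _ hu => rw [Algebra.smul_def, map_mul]; exact mul_mem (hc r) hu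
  induction hu using Submodule.span_induction with
  | mem u hu =>
    obtain ⟨c, d, hd, rfl⟩ := hu
    rw [map_sub, map_mul, map_mul]
    exact ringComm_of_mem_center (h2 d hd) (f c)
  | zero => simp
  | add u v _ _ hu hv => rw [map_add, hu, hv, add_zero]
  | smul r u _ hu => rw [Algebra.smul_def, map_mul, hu, mul_zero]

theorem ringComm_ringComm_mem_center_of_map_lcs_three (f : A →+* B)
    (hf : Function.Surjective f) (h : ∀ u ∈ lcs k A 3, f u = 0) (a b c : B) :
    ringComm (ringComm a b) c ∈ Subring.center B := by
  refine mem_center_iff_ringComm.2 fun d => ?_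
  obtain ⟨a, rfl⟩ := hf a
  obtain ⟨b, rfl⟩ := hf b
  obtain ⟨c, rfl⟩ := hf c
  obtain ⟨d, rfl⟩ := hf d
  rw [← map_ringComm, ← map_ringComm, ← map_ringComm]
  apply h
  have : ringComm (ringComm (ringComm a b) c) d = ringComm d (ringComm c (ringComm a b)) := by
    simp only [ringComm]; noncomm_ring
  rw [this]
  exact ringComm_mem_lcs_succ d (ringComm_mem_lcs_succ c (ringComm_mem_lcs_succ a trivial))

theorem eq_zero_of_add_add_eq_zero [CharZero k] (f : A →+* B) (hf : Function.Surjective f) (t : B)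
    (ht : t + t + t = 0) : t = 0 := by
  obtain ⟨s, rfl⟩ := hf t
  have h : s = algebraMap k A 3⁻¹ * (s + s + s) := by
    rw [← Algebra.smul_def]
    module
  rw [h, map_mul, map_add, map_add, ht, mul_zero]

end LowerCentralSeries

theorem FreeAlgebra.closure_range_ι_union_center (k X : Type*) [Field k] :
    Subring.closure (Set.range (FreeAlgebra.ι k : X → FreeAlgebra k X) ∪
      Subring.center (FreeAlgebra k X)) = ⊤ := by
  rw [eq_top_iff]
  rintro a -
  induction a using FreeAlgebra.induction with
  | grade0 r =>
    exact Subring.subset_closure (Or.inr (map_algebraMap_mem_center (RingHom.id _)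
      Function.surjective_id r))
  | grade1 i => exact Subring.subset_closure (Or.inl ⟨i, rfl⟩)
  | mul a b ha hb => exact mul_mem ha hb
  | add a b ha hb => exact add_mem ha hb

/-- In the free associative unital `ℂ`-algebra on `n` generators, the ideal `M_4` equals
the two-sided ideal generated by the elements `[x_i, z_{jlm}]`, the elements
`y_{ij}·z_{klm}`, and the elements `y_{ij}y_{kl}y_{mp} + y_{ik}y_{jl}y_{mp}`. -/
theorem Mser_four_eq_idealGen (n : ℕ) :
    Mser ℂ (FreeAlgebra ℂ (Fin n)) 4 =
      idealGen ℂ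
        ({w | ∃ i j l m : Fin n, w = ringComm (FreeAlgebra.ι ℂ i) (zGen j l m)} ∪
         {w | ∃ i j k l m : Fin n, w = yGen i j * zGen k l m} ∪
         {w | ∃ i j k l m p : Fin n,
            w = yGen i j * yGen k l * yGen m p + yGen i k * yGen j l * yGen m p}) := by
  set S : Set (FreeAlgebra ℂ (Fin n)) := _ ∪ _ ∪ _
  apply le_antisymm
  · apply idealGen_le_idealGen
    intro u hu
    have hf := idealGenQuotientMap_surjective (k := ℂ) S
    have hf0 : ∀ s ∈ S, idealGenQuotientMap ℂ S s = 0 := fun s hs =>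
      idealGenQuotientMap_eq_zero_iff.2 (subset_idealGen S hs)
    refine idealGenQuotientMap_eq_zero_iff.1 (map_eq_zero_of_mem_lcs_three _ hf ?_ hu)
    apply ringComm_ringComm_mem_center_of_generators
      (closure_range_comp_union_center _ hf (FreeAlgebra.closure_range_ι_union_center ℂ (Fin n)))
    · intro i j l m
      simp only [Function.comp, ← map_ringComm]
      exact hf0 _ (Or.inl (Or.inl ⟨i, j, l, m, rfl⟩))
    · intro i j k l m
      simp only [Function.comp, ← map_ringComm, ← map_mul]
      exact hf0 _ (Or.inl (Or.inr ⟨i, j, k, l, m, rfl⟩))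
    · intro i j k l m p
      simp only [Function.comp, ← map_ringComm, ← map_mul, ← map_add]
      exact hf0 _ (Or.inr ⟨i, j, k, l, m, p, rfl⟩)
  · apply idealGen_le_idealGen
    intro u hu
    let L : Set (FreeAlgebra ℂ (Fin n)) := Lser ℂ (FreeAlgebra ℂ (Fin n)) 4
    have hf := idealGenQuotientMap_surjective (k := ℂ) L
    have hL := ringComm_ringComm_mem_center_of_map_lcs_three (k := ℂ) _ hf fun u hu =>
      idealGenQuotientMap_eq_zero_iff.2 (subset_idealGen L hu)
    have h3 := eq_zero_of_add_add_eq_zero (k := ℂ) _ hf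
    refine idealGenQuotientMap_eq_zero_iff.1 ?_
    rcases hu with (⟨i, j, l, m, rfl⟩ | ⟨i, j, k, l, m, rfl⟩) | ⟨i, j, k, l, m, p, rfl⟩
    · simp only [zGen, yGen, map_ringComm]
      exact ringComm_of_mem_center (hL _ _ _) _
    · simp only [zGen, yGen, map_mul, map_ringComm]
      rw [Subring.mem_center_iff.1 (hL _ _ _)]
      exact ringComm_ringComm_mul_ringComm_eq_zero h3 hL _ _ _ _ _
    · simp only [yGen, map_mul, map_add, map_ringComm]
      exact ringComm_mul_ringComm_add_mul_ringComm_eq_zero h3 hL _ _ _ _ _ _
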